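/- arXiv:2006.04673 — 2 statements merged into one kernel-verified Lean document; each statement's English description precedes it below -/
import Mathlib

section
/- In the representation of the Boolean algebra of conditionals: (i) for all events A, C ⊆ Ω, ⟦A∣Ω⟧ = ⟦C∣Ω⟧ if and only if A = C; (ii) for every nonempty event B ⊆ Ω, ⟦Ω∖B ∣ B⟧ = ∅; (iii) for all events A, C ⊆ Ω and nonempty B ⊆ Ω, ⟦A∣B⟧ ∪ ⟦C∣B⟧ = ⟦A∪C∣B⟧. -/
open Finset

variable {Ω : Type*}

noncomputable def sigmaFirst [Fintype Ω] [DecidableEq Ω] [Nonempty Ω]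
    (σ : Fin (Fintype.card Ω) ≃ Ω) (B : Finset Ω) : Ω :=
  if h : (Finset.univ.filter fun i => σ i ∈ B).Nonempty then
    σ ((Finset.univ.filter fun i => σ i ∈ B).min' h)
  else Classical.arbitrary Ω

def condEvent [Fintype Ω] [DecidableEq Ω] [Nonempty Ω]
    (A B : Finset Ω) : Set (Fin (Fintype.card Ω) ≃ Ω) :=
  {σ | sigmaFirst σ B ∈ A}

theorem sigmaFirst_mem [Fintype Ω] [DecidableEq Ω] [Nonempty Ω]
    (σ : Fin (Fintype.card Ω) ≃ Ω) {B : Finset Ω} (hB : B.Nonempty) : sigmaFirst σ B ∈ B := by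
  obtain ⟨b, hb⟩ := hB
  have h : (Finset.univ.filter fun i => σ i ∈ B).Nonempty := ⟨σ.symm b, by simpa using hb⟩
  rw [sigmaFirst, dif_pos h]
  exact (Finset.mem_filter.mp (Finset.min'_mem _ h)).2

theorem exists_sigmaFirst_univ_eq [Fintype Ω] [DecidableEq Ω] [Nonempty Ω] (x : Ω) :
    ∃ σ : Fin (Fintype.card Ω) ≃ Ω, sigmaFirst σ Finset.univ = x := by
  let e := (Fintype.equivFin Ω).symm
  let i : Fin (Fintype.card Ω) := ⟨0, Fintype.card_pos⟩
  refine ⟨e.trans (Equiv.swap (e i) x), ?_⟩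
  have h : (Finset.univ.filter fun j =>
      (e.trans (Equiv.swap (e i) x)) j ∈ (Finset.univ : Finset Ω)).Nonempty := ⟨i, by simp⟩
  have hmin : Finset.min' _ h = i :=
    le_antisymm (Finset.min'_le _ _ (by simp)) (Fin.mk_le_of_le_val (Nat.zero_le _))
  rw [sigmaFirst, dif_pos h, hmin, Equiv.trans_apply, Equiv.swap_apply_left]

theorem stmt2 [Fintype Ω] [DecidableEq Ω] [Nonempty Ω] :
    (∀ A C : Finset Ω, condEvent A (Finset.univ : Finset Ω) = condEvent C Finset.univ ↔ A = C) ∧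
    (∀ B : Finset Ω, B.Nonempty → condEvent (Finset.univ \ B) B = (∅ : Set (Fin (Fintype.card Ω) ≃ Ω))) ∧
    (∀ A C B : Finset Ω, B.Nonempty →
      condEvent A B ∪ condEvent C B = condEvent (A ∪ C) B) := by
  refine ⟨fun A C => ⟨fun h => ?_, fun h => h ▸ rfl⟩, fun B hB => ?_, fun A C B _ => ?_⟩
  · ext x
    obtain ⟨σ, rfl⟩ := exists_sigmaFirst_univ_eq x
    exact Set.ext_iff.mp h σ
  · ext σ
    simp [condEvent, sigmaFirst_mem σ hB]
  · ext σ
    simp [condEvent]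
end

section
/- Let A, B, C, D ⊆ Ω be events with ∅ ≠ A ⊊ B and ∅ ≠ C ⊊ D (proper inclusions). Then: (i) if A ⊆ C and D ⊆ B then ⟦A∣B⟧ ⊆ ⟦C∣D⟧; (ii) if ⟦A∣B⟧ ⊆ ⟦C∣D⟧ then A ⊆ C; (iii) if C ⊆ B and ⟦A∣B⟧ ⊆ ⟦C∣D⟧ then D ⊆ B. -/
open Finset

variable {Ω : Type*}

theorem sigmaFirst_eq_of_forall_lt [Fintype Ω] [DecidableEq Ω] [Nonempty Ω]
    (σ : Fin (Fintype.card Ω) ≃ Ω) (B : Finset Ω) (i : Fin (Fintype.card Ω))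
    (hi : σ i ∈ B) (hlt : ∀ j < i, σ j ∉ B) : sigmaFirst σ B = σ i := by
  have hne : (Finset.univ.filter fun i => σ i ∈ B).Nonempty := ⟨i, by simpa using hi⟩
  rw [sigmaFirst, dif_pos hne]
  congr 1
  refine le_antisymm (Finset.min'_le _ _ (by simpa using hi)) (Finset.le_min' _ _ _ ?_)
  intro j hj
  by_contra! hji
  exact hlt j hji (by simpa using hj)

theorem exists_sigmaFirst_eq [Fintype Ω] [DecidableEq Ω] [Nonempty Ω]
    (σ : Fin (Fintype.card Ω) ≃ Ω) (B : Finset Ω) (hB : B.Nonempty) :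
    ∃ i, sigmaFirst σ B = σ i ∧ σ i ∈ B ∧ ∀ j < i, σ j ∉ B := by
  obtain ⟨b, hb⟩ := hB
  have hne : (Finset.univ.filter fun i => σ i ∈ B).Nonempty := ⟨σ.symm b, by simpa using hb⟩
  refine ⟨(Finset.univ.filter fun i => σ i ∈ B).min' hne, ?_, ?_, ?_⟩
  · rw [sigmaFirst, dif_pos hne]
  · simpa using Finset.min'_mem _ hne
  · intro j hj hjB
    exact absurd (Finset.min'_le _ j (by simpa using hjB)) (not_le.mpr hj)

/-- Any two elements can be listed first, in either order. -/
theorem exists_enumeration_starting_with [Fintype Ω] [DecidableEq Ω] [Nonempty Ω] (x y : Ω) :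
    ∃ σ : Fin (Fintype.card Ω) ≃ Ω, ∀ B : Finset Ω,
      (x ∈ B → sigmaFirst σ B = x) ∧ (x ∉ B → y ∈ B → sigmaFirst σ B = y) := by
  have e := (Fintype.equivFin Ω).symm
  let i₀ : Fin (Fintype.card Ω) := ⟨0, Fintype.card_pos⟩
  have not_lt_i₀ : ∀ j, ¬ j < i₀ := fun j hj => Nat.not_lt_zero _ hj
  let τ := e.trans (Equiv.swap (e i₀) x)
  have hτ : τ i₀ = x := by simp [τ]
  by_cases hxy : x = y
  · subst hxy
    refine ⟨τ, fun B => ⟨fun hx => ?_, fun hx hx' => absurd hx' hx⟩⟩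
    rw [sigmaFirst_eq_of_forall_lt τ B i₀ (hτ.symm ▸ hx) fun j hj => absurd hj (not_lt_i₀ j), hτ]
  · let i₁ : Fin (Fintype.card Ω) := ⟨1, Fintype.one_lt_card_iff.mpr ⟨x, y, hxy⟩⟩
    have hx₁ : x ≠ τ i₁ := by
      rw [← hτ]
      exact τ.injective.ne (by simp [i₀, i₁])
    let σ := τ.trans (Equiv.swap (τ i₁) y)
    have h₀ : σ i₀ = x := by
      simp only [σ, Equiv.trans_apply, hτ]
      exact Equiv.swap_apply_of_ne_of_ne hx₁ hxy
    have h₁ : σ i₁ = y := by simp [σ]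
    refine ⟨σ, fun B => ⟨fun hx => ?_, fun hx hy => ?_⟩⟩
    · rw [sigmaFirst_eq_of_forall_lt σ B i₀ (h₀.symm ▸ hx) fun j hj => absurd hj (not_lt_i₀ j), h₀]
    · rw [sigmaFirst_eq_of_forall_lt σ B i₁ (h₁.symm ▸ hy), h₁]
      intro j hj
      have hj₀ : j = i₀ := Fin.ext (Nat.lt_one_iff.mp hj)
      rwa [hj₀, h₀]

theorem stmt11 [Fintype Ω] [DecidableEq Ω] [Nonempty Ω]
    (A B C D : Finset Ω) (hA : A.Nonempty) (hAB : A ⊂ B)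
    (hC : C.Nonempty) (hCD : C ⊂ D) :
    (A ⊆ C → D ⊆ B → condEvent A B ⊆ condEvent C D) ∧
    (condEvent A B ⊆ condEvent C D → A ⊆ C) ∧
    (C ⊆ B → condEvent A B ⊆ condEvent C D → D ⊆ B) := by
  refine ⟨fun hAC hDB σ hσ => ?_, fun h a ha => ?_, fun hCB h d hd => ?_⟩
  · obtain ⟨i, hi, -, hlt⟩ := exists_sigmaFirst_eq σ B (hA.mono hAB.subset)
    have hiC : σ i ∈ C := hAC (hi ▸ hσ)
    change sigmaFirst σ D ∈ C
    rwa [sigmaFirst_eq_of_forall_lt σ D i (hCD.subset hiC) fun j hj hjD => hlt j hj (hDB hjD)]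
  · by_contra haC
    obtain ⟨d, hdD, hdC⟩ := Finset.exists_of_ssubset hCD
    obtain ⟨σ, hσ⟩ := exists_enumeration_starting_with a d
    have hmem : sigmaFirst σ D ∈ C := h (show sigmaFirst σ B ∈ A by
      rwa [(hσ B).1 (hAB.subset ha)])
    by_cases haD : a ∈ D
    · exact haC ((hσ D).1 haD ▸ hmem)
    · exact hdC ((hσ D).2 haD hdD ▸ hmem)
  · by_contra hdB
    obtain ⟨a, ha⟩ := hA
    obtain ⟨σ, hσ⟩ := exists_enumeration_starting_with d a
    have hmem : sigmaFirst σ D ∈ C := h (show sigmaFirst σ B ∈ A by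
      rwa [(hσ B).2 hdB (hAB.subset ha)])
    exact hdB (hCB ((hσ D).1 hd ▸ hmem))
end
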